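/- arXiv:1910.03547 — 2 statements merged into one kernel-verified Lean document; each statement's English description precedes it below -/
import Mathlib

section
/- Let n ≥ 1 and let R = (−1,1)ⁿ⁻¹ × (0,1) ⊂ ℝⁿ, writing points of ℝⁿ as (x′, t) with x′ ∈ ℝⁿ⁻¹ and t ∈ ℝ. Let u : ℝⁿ → ℝ be continuously differentiable. Then for every t ∈ [0,1), (∫_{(−1,1)ⁿ⁻¹} u(x′, t) dx′)² ≤ 2 (∫_{(−1,1)ⁿ⁻¹} u(x′, 0) dx′)² + 2 (∫_R ‖∇u(x)‖ dx)². -/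
open MeasureTheory

/-- The point `(x', t)` of `ℝⁿ⁺¹`, with `x' ∈ ℝⁿ` and last coordinate `t`. -/
noncomputable def withLast (m : ℕ) (x' : EuclideanSpace ℝ (Fin m)) (t : ℝ) :
    EuclideanSpace ℝ (Fin (m + 1)) := WithLp.toLp 2 (Fin.snoc (α := fun _ => ℝ) x'.ofLp t)


noncomputable def sliceMap (m : ℕ) (p : ℝ × EuclideanSpace ℝ (Fin m)) : EuclideanSpace ℝ (Fin (m + 1)) :=
  withLast m p.2 p.1

lemma sliceMap_continuous (m : ℕ) : Continuous (sliceMap m) := by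
  unfold sliceMap withLast
  refine (PiLp.continuous_toLp 2 _).comp ?_
  exact Continuous.finSnoc (A := fun _ => ℝ) ((PiLp.continuous_ofLp 2 _).comp continuous_snd)
    continuous_fst

lemma withLast_castSucc (m : ℕ) (x : EuclideanSpace ℝ (Fin m)) (t : ℝ) (i : Fin m) :
    withLast m x t i.castSucc = x i := by simp [withLast]

lemma withLast_last (m : ℕ) (x : EuclideanSpace ℝ (Fin m)) (t : ℝ) :
    withLast m x t (Fin.last m) = t := by simp [withLast]

lemma sliceMap_inj (m : ℕ) : Function.Injective (sliceMap m) := by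
  rintro ⟨s, x⟩ ⟨t, y⟩ h
  simp only [sliceMap] at h
  refine Prod.ext ?_ ?_
  · rw [← withLast_last m x s, h, withLast_last]
  · ext i
    change x i = y i
    rw [← withLast_castSucc m x s, h, withLast_castSucc]

lemma sliceMap_mp (m : ℕ) : MeasurePreserving (sliceMap m) := by
  have h1 : MeasurePreserving (Prod.map id (WithLp.ofLp) :
      ℝ × EuclideanSpace ℝ (Fin m) → ℝ × (Fin m → ℝ)) :=
    (MeasurePreserving.id volume).prod (PiLp.volume_preserving_ofLp (Fin m))
  have h2 := (volume_preserving_piFinSuccAbove (fun _ : Fin (m + 1) => ℝ) (Fin.last m)).symm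
  have h3 := (PiLp.volume_preserving_toLp (Fin (m + 1))).comp (h2.comp h1)
  convert h3 using 1
  funext p
  simp only [sliceMap, withLast, Function.comp]
  congr 1
  funext i
  refine Fin.lastCases ?_ (fun j => ?_) i
  · simp [MeasurableEquiv.piFinSuccAbove]
  · simp [MeasurableEquiv.piFinSuccAbove, Fin.insertNth_last']

lemma withLast_hasDerivAt (m : ℕ) (x : EuclideanSpace ℝ (Fin m)) (t : ℝ) :
    HasDerivAt (fun s => withLast m x s) (EuclideanSpace.single (Fin.last m) (1 : ℝ)) t := by
  have : (fun s => withLast m x s) =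
      fun s => withLast m x 0 + s • EuclideanSpace.single (Fin.last m) (1 : ℝ) := by
    funext s
    ext i
    refine Fin.lastCases ?_ (fun j => ?_) i
    · simp [withLast]
    · simp [withLast]
  rw [this]
  simpa using ((hasDerivAt_id t).smul_const
    (EuclideanSpace.single (Fin.last m) (1 : ℝ))).const_add (withLast m x 0)

lemma cube_bounded (m : ℕ) :
    Bornology.IsBounded {x' : EuclideanSpace ℝ (Fin m) | ∀ i, x' i ∈ Set.Ioo (-1 : ℝ) 1} := by
  refine (PiLp.antilipschitzWith_ofLp 2 (fun _ : Fin m => ℝ)).isBounded_preimage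
    (s := Set.pi Set.univ fun _ => Set.Ioo (-1 : ℝ) 1)
    (Bornology.IsBounded.pi fun _ => Metric.isBounded_Ioo _ _) |>.subset ?_
  intro x hx
  simpa using hx

lemma cube_meas (m : ℕ) :
    MeasurableSet {x' : EuclideanSpace ℝ (Fin m) | ∀ i, x' i ∈ Set.Ioo (-1 : ℝ) 1} := by
  rw [Set.ofPred_forall]
  exact MeasurableSet.iInter fun i => measurableSet_Ioo.preimage (by fun_prop)

lemma integrableOn_of_bdd {E : Type*} [NormedAddCommGroup E] [ProperSpace E] [MeasureSpace E]
    [BorelSpace E] [IsFiniteMeasureOnCompacts (volume : Measure E)]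
    {f : E → ℝ} (hf : Continuous f) {s : Set E} (hs : Bornology.IsBounded s) :
    IntegrableOn f s :=
  (hf.continuousOn.integrableOn_compact hs.isCompact_closure).mono_set subset_closure

lemma slice_pointwise (m : ℕ) (u : EuclideanSpace ℝ (Fin (m + 1)) → ℝ)
    (hu : ContDiff ℝ 1 u) (t : ℝ) (ht : t ∈ Set.Ico (0 : ℝ) 1) (x : EuclideanSpace ℝ (Fin m)) :
    ‖u (withLast m x t) - u (withLast m x 0)‖ ≤
      ∫ s in Set.Ioo (0 : ℝ) 1, ‖fderiv ℝ u (withLast m x s)‖ := by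
  have hw : Continuous (fun s => withLast m x s) :=
    (sliceMap_continuous m).comp (by fun_prop : Continuous fun s : ℝ => (s, x))
  have hfd : Continuous (fun s => fderiv ℝ u (withLast m x s)) :=
    (hu.continuous_fderiv (by norm_num)).comp hw
  have hd : ∀ s, HasDerivAt (fun s => u (withLast m x s))
      (fderiv ℝ u (withLast m x s) (EuclideanSpace.single (Fin.last m) (1 : ℝ))) s := fun s =>
    ((hu.differentiable (by norm_num)) _).hasFDerivAt.comp_hasDerivAt s (withLast_hasDerivAt m x s)
  have hc : Continuous (fun s =>
      fderiv ℝ u (withLast m x s) (EuclideanSpace.single (Fin.last m) (1 : ℝ))) :=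
    hfd.clm_apply continuous_const
  rw [← intervalIntegral.integral_eq_sub_of_hasDerivAt (fun s _ => hd s)
    (hc.intervalIntegrable 0 t)]
  calc _ ≤ ∫ s in (0 : ℝ)..t, ‖fderiv ℝ u (withLast m x s)‖ := by
        refine intervalIntegral.norm_integral_le_of_norm_le ht.1 ?_
          (hfd.norm.intervalIntegrable 0 t)
        refine Filter.Eventually.of_forall fun s _ => ?_
        simpa using (fderiv ℝ u (withLast m x s)).le_opNorm
          (EuclideanSpace.single (Fin.last m) (1 : ℝ))
    _ = ∫ s in Set.Ioc (0 : ℝ) t, ‖fderiv ℝ u (withLast m x s)‖ :=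
        intervalIntegral.integral_of_le ht.1
    _ ≤ _ := by
        refine setIntegral_mono_set (integrableOn_of_bdd hfd.norm (Metric.isBounded_Ioo _ _))
          (Filter.Eventually.of_forall fun s => norm_nonneg _) ?_
        exact (Set.Ioc_subset_Ioo_right ht.2 : Set.Ioc 0 t ⊆ Set.Ioo 0 1).eventuallyLE

/-- Bound on the square of a slice integral by the square of the bottom slice integral
plus the square of the total gradient integral (proof of Lemma 4.3 of the paper).
(Here the dimension is `m + 1`, covering all dimensions `n ≥ 1`.) -/
theorem slice_square_estimate (m : ℕ) (u : EuclideanSpace ℝ (Fin (m + 1)) → ℝ)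
    (hu : ContDiff ℝ 1 u) (t : ℝ) (ht : t ∈ Set.Ico (0 : ℝ) 1) :
    (∫ x' in {x' : EuclideanSpace ℝ (Fin m) | ∀ i, x' i ∈ Set.Ioo (-1 : ℝ) 1},
        u (withLast m x' t)) ^ 2
      ≤ 2 * (∫ x' in {x' : EuclideanSpace ℝ (Fin m) | ∀ i, x' i ∈ Set.Ioo (-1 : ℝ) 1},
            u (withLast m x' 0)) ^ 2
        + 2 * (∫ x in {x : EuclideanSpace ℝ (Fin (m + 1)) |
              (∀ i : Fin m, x i.castSucc ∈ Set.Ioo (-1 : ℝ) 1) ∧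
                x (Fin.last m) ∈ Set.Ioo (0 : ℝ) 1},
            ‖fderiv ℝ u x‖) ^ 2 := by
  have hu0 := hu.continuous
  have hG : Continuous fun p => ‖fderiv ℝ u (sliceMap m p)‖ :=
    ((hu.continuous_fderiv (by norm_num)).comp (sliceMap_continuous m)).norm
  have hI : ∀ s : ℝ, IntegrableOn (fun x' => u (withLast m x' s))
      {x' : EuclideanSpace ℝ (Fin m) | ∀ i, x' i ∈ Set.Ioo (-1 : ℝ) 1} := fun s =>
    integrableOn_of_bdd (hu0.comp ((sliceMap_continuous m).comp
      (by fun_prop : Continuous fun x : EuclideanSpace ℝ (Fin m) => (s, x)))) (cube_bounded m)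
  have hP : IntegrableOn (fun p => ‖fderiv ℝ u (sliceMap m p)‖) (Set.Ioo (0 : ℝ) 1 ×ˢ
      {x' : EuclideanSpace ℝ (Fin m) | ∀ i, x' i ∈ Set.Ioo (-1 : ℝ) 1})
      ((volume : Measure ℝ).prod volume) :=
    integrableOn_of_bdd hG ((Metric.isBounded_Ioo _ _).prod (cube_bounded m))
  have hR : (∫ x in {x : EuclideanSpace ℝ (Fin (m + 1)) |
              (∀ i : Fin m, x i.castSucc ∈ Set.Ioo (-1 : ℝ) 1) ∧
                x (Fin.last m) ∈ Set.Ioo (0 : ℝ) 1}, ‖fderiv ℝ u x‖) =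
      ∫ x' in {x' : EuclideanSpace ℝ (Fin m) | ∀ i, x' i ∈ Set.Ioo (-1 : ℝ) 1},
        ∫ s in Set.Ioo (0 : ℝ) 1, ‖fderiv ℝ u (withLast m x' s)‖ := by
    rw [← (sliceMap_mp m).setIntegral_preimage_emb
      ((sliceMap_continuous m).measurableEmbedding (sliceMap_inj m))]
    have : (sliceMap m ⁻¹' {x : EuclideanSpace ℝ (Fin (m + 1)) |
              (∀ i : Fin m, x i.castSucc ∈ Set.Ioo (-1 : ℝ) 1) ∧
                x (Fin.last m) ∈ Set.Ioo (0 : ℝ) 1}) = Set.Ioo (0 : ℝ) 1 ×ˢ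
      {x' : EuclideanSpace ℝ (Fin m) | ∀ i, x' i ∈ Set.Ioo (-1 : ℝ) 1} := by
      ext p
      simp only [sliceMap, Set.mem_preimage, Set.mem_setOf_eq, withLast_castSucc, withLast_last,
        Set.mem_prod]
      exact and_comm
    rw [this, Measure.volume_eq_prod, ← Measure.prod_restrict]
    rw [IntegrableOn, ← Measure.prod_restrict] at hP
    rw [integral_prod_symm _ hP]
    rfl
  rw [IntegrableOn, ← Measure.prod_restrict] at hP
  have key := norm_integral_le_of_norm_le hP.integral_prod_right
    (Filter.Eventually.of_forall fun x' => slice_pointwise m u hu t ht x')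
  rw [integral_sub (hI t) (hI 0)] at key
  rw [hR]
  change _ ≤ ∫ x' in {x' : EuclideanSpace ℝ (Fin m) | ∀ i, x' i ∈ Set.Ioo (-1 : ℝ) 1},
        ∫ s in Set.Ioo (0 : ℝ) 1, ‖fderiv ℝ u (withLast m x' s)‖ at key
  generalize (∫ x' in {x' : EuclideanSpace ℝ (Fin m) | ∀ i, x' i ∈ Set.Ioo (-1 : ℝ) 1},
        ∫ s in Set.Ioo (0 : ℝ) 1, ‖fderiv ℝ u (withLast m x' s)‖) = G at *
  generalize (∫ x' in {x' : EuclideanSpace ℝ (Fin m) | ∀ i, x' i ∈ Set.Ioo (-1 : ℝ) 1},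
        u (withLast m x' t)) = A at *
  generalize (∫ x' in {x' : EuclideanSpace ℝ (Fin m) | ∀ i, x' i ∈ Set.Ioo (-1 : ℝ) 1},
        u (withLast m x' 0)) = B at *
  rw [Real.norm_eq_abs] at key
  have h2 : (A - B) ^ 2 ≤ G ^ 2 := sq_le_sq' (by linarith [neg_abs_le (A - B)])
    (le_trans (le_abs_self _) key)
  nlinarith [sq_nonneg (B - (A - B))]
end

section
/- Let n ≥ 1. There exists a constant C > 0 depending only on n such that for every continuously differentiable function u : ℝⁿ → ℝ, with R = (−1,1)ⁿ⁻¹ × (0,1) ⊂ ℝⁿ (points written (x′, t), x′ ∈ ℝⁿ⁻¹, t ∈ ℝ), one has ∫_R u(x)² dx ≤ C ( ∫_R ‖∇u(x)‖² dx + ∫_{(−1,1)ⁿ⁻¹} u(x′, 0)² dx′ ). -/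
open MeasureTheory

lemma withLast_mp (m : ℕ) :
    MeasurePreserving (fun p : EuclideanSpace ℝ (Fin m) × ℝ => withLast m p.1 p.2)
      (volume.prod volume) volume ∧
    MeasurableEmbedding (fun p : EuclideanSpace ℝ (Fin m) × ℝ => withLast m p.1 p.2) := by
  let e1 : EuclideanSpace ℝ (Fin m) × ℝ ≃ᵐ (Fin m → ℝ) × ℝ :=
    (MeasurableEquiv.toLp 2 (Fin m → ℝ)).symm.prodCongr (MeasurableEquiv.refl ℝ)
  let e2 : (Fin m → ℝ) × ℝ ≃ᵐ ℝ × (Fin m → ℝ) := MeasurableEquiv.prodComm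
  let e3 : ℝ × (Fin m → ℝ) ≃ᵐ (Fin (m+1) → ℝ) :=
    (MeasurableEquiv.piFinSuccAbove (fun _ => ℝ) (Fin.last m)).symm
  let e4 : (Fin (m+1) → ℝ) ≃ᵐ EuclideanSpace ℝ (Fin (m+1)) := MeasurableEquiv.toLp 2 _
  have h1 : MeasurePreserving e1 (volume.prod volume) (volume.prod volume) :=
    (EuclideanSpace.volume_preserving_symm_measurableEquiv_toLp (Fin m)).prod
      (MeasurePreserving.id volume)
  have h2 : MeasurePreserving e2 (volume.prod volume) (volume.prod volume) :=
    Measure.measurePreserving_swap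
  have h3 : MeasurePreserving e3 (volume.prod volume) volume :=
    (volume_preserving_piFinSuccAbove (fun _ => ℝ) (Fin.last m)).symm
  have h4 : MeasurePreserving e4 volume volume :=
    (EuclideanSpace.volume_preserving_symm_measurableEquiv_toLp (Fin (m+1))).symm
  have key : (fun p : EuclideanSpace ℝ (Fin m) × ℝ => withLast m p.1 p.2)
      = e4 ∘ e3 ∘ e2 ∘ e1 := by
    funext p
    ext i
    simp [e1, e2, e3, e4, withLast, MeasurableEquiv.prodComm,
      MeasurableEquiv.piFinSuccAbove, MeasurableEquiv.prodCongr, Fin.insertNthEquiv]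
    try rfl
  rw [key]
  exact ⟨h4.comp (h3.comp (h2.comp h1)),
    e4.measurableEmbedding.comp (e3.measurableEmbedding.comp
      (e2.measurableEmbedding.comp e1.measurableEmbedding))⟩

lemma oneD (g g' h : ℝ → ℝ) (hg : ∀ s, HasDerivAt g (g' s) s) (hg' : Continuous g')
    (hh : Continuous h) (hle : ∀ s, |g' s| ≤ h s) (t : ℝ) (ht : t ∈ Set.Ioo (0:ℝ) 1) :
    g t ^ 2 ≤ 2 * g 0 ^ 2 + 2 * ∫ s in Set.Ioo (0:ℝ) 1, h s ^ 2 := by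
  rw [← integral_Ioc_eq_integral_Ioo, ← intervalIntegral.integral_of_le zero_le_one]
  have h0 : ∀ s, 0 ≤ h s := fun s => (abs_nonneg _).trans (hle s)
  set b := ∫ s in (0:ℝ)..1, h s with hb
  have e1 : ∫ s in (0:ℝ)..t, g' s = g t - g 0 :=
    intervalIntegral.integral_eq_sub_of_hasDerivAt (fun s _ => hg s)
      (hg'.intervalIntegrable _ _)
  have e2 : |g t - g 0| ≤ b := by
    rw [← e1]
    calc |∫ s in (0:ℝ)..t, g' s| ≤ ∫ s in (0:ℝ)..t, |g' s| :=
          intervalIntegral.abs_integral_le_integral_abs ht.1.le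
      _ ≤ ∫ s in (0:ℝ)..t, h s :=
          intervalIntegral.integral_mono_on ht.1.le (hg'.abs.intervalIntegrable _ _)
            (hh.intervalIntegrable _ _) (fun s _ => hle s)
      _ ≤ b := by
          rw [hb, ← intervalIntegral.integral_add_adjacent_intervals
            (hh.intervalIntegrable 0 t) (hh.intervalIntegrable t 1)]
          have := intervalIntegral.integral_nonneg (μ := volume) ht.2.le (fun s _ => h0 s)
          linarith
  have e3 : b ^ 2 ≤ ∫ s in (0:ℝ)..1, h s ^ 2 := by
    have p : 0 ≤ ∫ s in (0:ℝ)..1, (h s - b) ^ 2 :=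
      intervalIntegral.integral_nonneg zero_le_one (fun s _ => sq_nonneg _)
    have q : ∫ s in (0:ℝ)..1, (h s - b) ^ 2
        = (∫ s in (0:ℝ)..1, h s ^ 2) - 2 * b * b + b ^ 2 := by
      have : ∀ s, (h s - b) ^ 2 = h s ^ 2 - 2 * b * h s + b ^ 2 := fun s => by ring
      simp_rw [this]
      rw [intervalIntegral.integral_add, intervalIntegral.integral_sub,
        intervalIntegral.integral_const_mul]
      · simp [hb]
      all_goals exact Continuous.intervalIntegrable (by fun_prop) _ _
    nlinarith
  have e4 : (g t - g 0) ^ 2 ≤ b ^ 2 := by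
    rw [← sq_abs]; exact pow_le_pow_left₀ (abs_nonneg _) e2 2
  nlinarith [sq_nonneg (g t - 2 * g 0)]

lemma rect_int (m : ℕ) (f : EuclideanSpace ℝ (Fin m) → ℝ) (hf : Continuous f)
    (a : Fin m → ℝ) (b : Fin m → ℝ) (S : Set (EuclideanSpace ℝ (Fin m)))
    (hS : ∀ x ∈ S, ∀ i, x i ∈ Set.Icc (a i) (b i)) :
    IntegrableOn f S := by
  have hK : IsCompact ((EuclideanSpace.equiv (Fin m) ℝ) ⁻¹' (Set.Icc a b)) :=
    (EuclideanSpace.equiv (Fin m) ℝ).toHomeomorph.isCompact_preimage.2 isCompact_Icc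
  refine (hf.continuousOn.integrableOn_compact hK).mono_set ?_
  intro x hx
  exact ⟨fun i => (hS x hx i).1, fun i => (hS x hx i).2⟩

/-- Inequality (4.10) in the proof of Lemma 4.3 of the paper: the `L²` norm of `u` on the
rectangular solid `R = (−1,1)ⁿ⁻¹ × (0,1)` is bounded by the Dirichlet energy on `R` plus
the `L²` norm of `u` on the bottom face, with a constant depending only on the dimension.
(Here the dimension is `m + 1`, covering all dimensions `n ≥ 1`.) -/
theorem rectangle_L2_bound (m : ℕ) :
    ∃ C : ℝ, 0 < C ∧ ∀ u : EuclideanSpace ℝ (Fin (m + 1)) → ℝ, ContDiff ℝ 1 u →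
      ∫ x in {x : EuclideanSpace ℝ (Fin (m + 1)) |
          (∀ i : Fin m, x i.castSucc ∈ Set.Ioo (-1 : ℝ) 1) ∧
            x (Fin.last m) ∈ Set.Ioo (0 : ℝ) 1}, (u x) ^ 2
        ≤ C * ((∫ x in {x : EuclideanSpace ℝ (Fin (m + 1)) |
                (∀ i : Fin m, x i.castSucc ∈ Set.Ioo (-1 : ℝ) 1) ∧
                  x (Fin.last m) ∈ Set.Ioo (0 : ℝ) 1}, ‖fderiv ℝ u x‖ ^ 2)
              + ∫ x' in {x' : EuclideanSpace ℝ (Fin m) | ∀ i, x' i ∈ Set.Ioo (-1 : ℝ) 1},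
                  (u (withLast m x' 0)) ^ 2) := by
  refine ⟨2, by norm_num, fun u hu => ?_⟩
  set R := {x : EuclideanSpace ℝ (Fin (m + 1)) |
          (∀ i : Fin m, x i.castSucc ∈ Set.Ioo (-1 : ℝ) 1) ∧
            x (Fin.last m) ∈ Set.Ioo (0 : ℝ) 1} with hR
  set Q := {x' : EuclideanSpace ℝ (Fin m) | ∀ i, x' i ∈ Set.Ioo (-1 : ℝ) 1} with hQ
  obtain ⟨mp, me⟩ := withLast_mp m
  have hpre : (fun p : EuclideanSpace ℝ (Fin m) × ℝ => withLast m p.1 p.2) ⁻¹' R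
      = Q ×ˢ Set.Ioo (0:ℝ) 1 := by
    ext p
    simp [hR, hQ, withLast]
  have hRi : ∀ f : EuclideanSpace ℝ (Fin (m+1)) → ℝ, Continuous f → IntegrableOn f R := by
    intro f hf
    refine rect_int _ f hf (fun _ => -1) (fun _ => 1) R ?_
    intro x hx i
    refine Fin.lastCases ?_ (fun i => ?_) i
    · exact ⟨by linarith [hx.2.1], hx.2.2.le⟩
    · exact ⟨(hx.1 i).1.le, (hx.1 i).2.le⟩
  have hPi : ∀ f : EuclideanSpace ℝ (Fin (m+1)) → ℝ, Continuous f →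
      IntegrableOn (fun p : EuclideanSpace ℝ (Fin m) × ℝ => f (withLast m p.1 p.2))
        (Q ×ˢ Set.Ioo (0:ℝ) 1) (volume.prod volume) := by
    intro f hf
    have := (mp.integrableOn_comp_preimage me (f := f) (s := R)).2 (hRi f hf)
    rw [hpre] at this
    exact this
  have hPe : ∀ f : EuclideanSpace ℝ (Fin (m+1)) → ℝ, Continuous f →
      ∫ x in R, f x = ∫ x' in Q, ∫ t in Set.Ioo (0:ℝ) 1, f (withLast m x' t) := by
    intro f hf
    rw [← mp.setIntegral_preimage_emb me f R, hpre]
    exact setIntegral_prod _ (hPi f hf)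
  have hPl : ∀ f : EuclideanSpace ℝ (Fin (m+1)) → ℝ, Continuous f →
      IntegrableOn (fun x' => ∫ t in Set.Ioo (0:ℝ) 1, f (withLast m x' t)) Q := by
    intro f hf
    have := hPi f hf
    rw [IntegrableOn, ← Measure.prod_restrict] at this
    exact this.integral_prod_left
  have hcf : Continuous (fun x => fderiv ℝ u x) := hu.continuous_fderiv one_ne_zero
  have hc1 : Continuous (fun x => u x ^ 2) := hu.continuous.pow 2
  have hc2 : Continuous (fun x => ‖fderiv ℝ u x‖ ^ 2) := hcf.norm.pow 2
  have hw : ∀ x', Continuous (fun t : ℝ => withLast m x' t) := by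
    intro x'
    unfold withLast
    fun_prop
  have hw0 : Continuous (fun x' => withLast m x' 0) := by
    unfold withLast
    fun_prop
  have hdir : ∀ x' (s : ℝ), HasDerivAt (fun t : ℝ => withLast m x' t)
      (EuclideanSpace.single (Fin.last m) (1:ℝ)) s := by
    intro x' s
    have : (fun t : ℝ => withLast m x' t) = fun t => withLast m x' 0 +
        t • EuclideanSpace.single (Fin.last m) (1:ℝ) := by
      funext t
      ext i
      refine Fin.lastCases ?_ (fun i => ?_) i <;> simp [withLast, Fin.castSucc_ne_last]
    rw [this]
    simpa using ((hasDerivAt_id s).smul_const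
      (EuclideanSpace.single (Fin.last m) (1:ℝ))).const_add (withLast m x' 0)
  have hQi : IntegrableOn (fun x' => u (withLast m x' 0) ^ 2) Q :=
    rect_int _ _ (hc1.comp hw0) (fun _ => -1) (fun _ => 1) Q
      (fun x hx i => ⟨(hx i).1.le, (hx i).2.le⟩)
  have hQm : MeasurableSet Q := by
    have : Q = ⋂ i, (fun x' : EuclideanSpace ℝ (Fin m) => x' i) ⁻¹' Set.Ioo (-1 : ℝ) 1 := by
      ext x; simp [hQ]
    rw [this]
    exact MeasurableSet.iInter fun i =>
      (isOpen_Ioo.preimage (by fun_prop)).measurableSet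
  rw [hPe _ hc1, hPe _ hc2, ← integral_add (hPl _ hc2) hQi, ← integral_const_mul]
  refine setIntegral_mono_on (hPl _ hc1) (((hPl _ hc2).add hQi).const_mul 2) hQm ?_
  intro x' _
  have key := oneD (fun t => u (withLast m x' t))
    (fun t => fderiv ℝ u (withLast m x' t) (EuclideanSpace.single (Fin.last m) (1:ℝ)))
    (fun t => ‖fderiv ℝ u (withLast m x' t)‖)
    (fun s => (((hu.differentiable one_ne_zero) _).hasFDerivAt).comp_hasDerivAt s (hdir x' s))
    ((hcf.comp (hw x')).clm_apply continuous_const)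
    (hcf.comp (hw x')).norm
    (fun s => by
      have := (fderiv ℝ u (withLast m x' s)).le_opNorm
        (EuclideanSpace.single (Fin.last m) (1:ℝ))
      simpa using this)
  set K := ∫ t in Set.Ioo (0:ℝ) 1, ‖fderiv ℝ u (withLast m x' t)‖ ^ 2 with hK
  have hi : IntegrableOn (fun t => u (withLast m x' t) ^ 2) (Set.Ioo (0:ℝ) 1) :=
    ((hc1.comp (hw x')).continuousOn.integrableOn_compact isCompact_Icc).mono_set
      Set.Ioo_subset_Icc_self
  calc ∫ t in Set.Ioo (0:ℝ) 1, u (withLast m x' t) ^ 2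
      ≤ ∫ t in Set.Ioo (0:ℝ) 1, (2 * u (withLast m x' 0) ^ 2 + 2 * K) :=
        setIntegral_mono_on hi (by simp) measurableSet_Ioo key
    _ = 2 * (K + u (withLast m x' 0) ^ 2) := by
        simp
        ring
end
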